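/- arXiv:1405.7210 — 5 statements merged into one kernel-verified Lean document; each statement's English description precedes it below -/
import Mathlib

section
/- Let Ψ(x_1,x_2,x_3,x_4) = (1/4) Σ_{π} 1{max(x_{i_1},x_{i_2},x_{i_3}) < x_{i_4}} − (1/24) Σ_{π} 1{max(x_{i_1},x_{i_2}) + x_{i_3}/3 < x_{i_4}}, where the first sum runs over the 4 choices of which index plays the role of i_4 and the second sum over all 24 permutations (i_1,i_2,i_3,i_4) of (1,2,3,4). Then for every s ≥ 0, the conditional expectation of Ψ(X_1,X_2,X_3,X_4) given X_4 = s, for X_1,X_2,X_3 i.i.d. Exp(1), equals ψ(s); that is, ∫_0^∞∫_0^∞∫_0^∞ Ψ(x,y,z,s) e^{-(x+y+z)} dx dy dz = (3/8)e^{-s} − (9/16)e^{-2s} + (1/4)e^{-3s} − (1/12)e^{-s/3}. -/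
open Real MeasureTheory

/-- The centered kernel `Ψ` of the integral statistic `I_n`: the first sum runs over the
4 choices of which argument plays the role of `i₄`, the second over all 24 permutations. -/
noncomputable def PsiKernel (x₁ x₂ x₃ x₄ : ℝ) : ℝ :=
  (1/4) * ((if max (max x₂ x₃) x₄ < x₁ then (1:ℝ) else 0)
    + (if max (max x₁ x₃) x₄ < x₂ then (1:ℝ) else 0)
    + (if max (max x₁ x₂) x₄ < x₃ then (1:ℝ) else 0)
    + (if max (max x₁ x₂) x₃ < x₄ then (1:ℝ) else 0))
  - (1/24) * ∑ σ : Equiv.Perm (Fin 4),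
      (if max (![x₁, x₂, x₃, x₄] (σ 0)) (![x₁, x₂, x₃, x₄] (σ 1))
          + ![x₁, x₂, x₃, x₄] (σ 2) / 3 < ![x₁, x₂, x₃, x₄] (σ 3) then (1:ℝ) else 0)

/-- The projection `ψ` of the kernel `Ψ`. -/
noncomputable def psi (s : ℝ) : ℝ :=
  (3/8) * exp (-s) - (9/16) * exp (-2*s) + (1/4) * exp (-3*s) - (1/12) * exp (-s/3)

open Set

/-- The standard exponential distribution, as a measure on the real line. -/
noncomputable def stdExp : Measure ℝ :=
  (volume.restrict (Ioi 0)).withDensity fun x => ENNReal.ofReal (exp (-x))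

lemma integral_stdExp (f : ℝ → ℝ) :
    ∫ x, f x ∂stdExp = ∫ x in Ioi (0:ℝ), f x * exp (-x) := by
  rw [stdExp, integral_withDensity_eq_integral_toReal_smul (by fun_prop) (by simp)]
  refine integral_congr_ae (.of_forall fun x => ?_)
  simp [ENNReal.toReal_ofReal (exp_pos _).le, mul_comm]

instance : IsProbabilityMeasure stdExp := by
  constructor
  rw [stdExp, withDensity_apply _ MeasurableSet.univ, Measure.restrict_univ,
    ← ofReal_integral_eq_lintegral_ofReal (integrableOn_exp_neg_Ioi 0)
      (.of_forall fun x => (exp_pos _).le), integral_exp_neg_Ioi]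
  simp

lemma ae_stdExp_pos : ∀ᵐ x ∂stdExp, 0 < x :=
  (withDensity_absolutelyContinuous _ _).ae_le (ae_restrict_mem measurableSet_Ioi)

lemma integral_exp_neg_mul_Ioi {c : ℝ} (hc : 0 < c) (t : ℝ) :
    ∫ x in Ioi t, exp (-(c * x)) = exp (-(c * t)) / c := by
  have h := integral_exp_mul_Ioi (a := -c) (by linarith) t
  simp only [neg_mul] at h
  rw [h]; field_simp

lemma setIntegral_stdExp {t : ℝ} (ht : 0 ≤ t) (f : ℝ → ℝ) :
    ∫ x in Ioi t, f x ∂stdExp = ∫ x in Ioi t, f x * exp (-x) := by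
  rw [stdExp, restrict_withDensity measurableSet_Ioi, Measure.restrict_restrict measurableSet_Ioi,
    Ioi_inter_Ioi, max_eq_left ht,
    integral_withDensity_eq_integral_toReal_smul (by fun_prop) (by simp)]
  refine integral_congr_ae (.of_forall fun x => ?_)
  simp [ENNReal.toReal_ofReal (exp_pos _).le, mul_comm]

lemma stdExp_real_Ioi {t : ℝ} (ht : 0 ≤ t) : stdExp.real (Ioi t) = exp (-t) := by
  have h := setIntegral_stdExp ht fun _ => 1
  simpa only [one_mul, integral_exp_neg_Ioi, setIntegral_const, smul_eq_mul, mul_one] using h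

lemma stdExp_real_Iic {t : ℝ} (ht : 0 ≤ t) : stdExp.real (Iic t) = 1 - exp (-t) := by
  rw [← compl_Ioi, probReal_compl_eq_one_sub measurableSet_Ioi, stdExp_real_Ioi ht]

instance : NullSingletonClass stdExp := by
  unfold stdExp; infer_instance

lemma integrable_exp_neg_mul_max {k : ℝ} (hk : 0 ≤ k) {t : ℝ} (ht : 0 ≤ t) :
    Integrable (fun x => exp (-(k * max x t))) stdExp :=
  Integrable.of_bound (by fun_prop) 1 (.of_forall fun x => by
    rw [Real.norm_eq_abs, abs_exp, exp_le_one_iff]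
    have := mul_nonneg hk (ht.trans (le_max_right x t)); linarith)

lemma integral_exp_neg_mul_max {k : ℝ} (hk : 0 ≤ k) {t : ℝ} (ht : 0 ≤ t) :
    ∫ x, exp (-(k * max x t)) ∂stdExp
      = exp (-(k * t)) - k / (k + 1) * exp (-((k + 1) * t)) := by
  rw [← integral_add_compl measurableSet_Ioi (integrable_exp_neg_mul_max hk ht) (s := Ioi t),
    compl_Ioi, setIntegral_stdExp ht,
    setIntegral_congr_fun (g := fun _ => exp (-(k * t))) measurableSet_Iic
      fun x hx => by simp [max_eq_right (mem_Iic.1 hx)],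
    setIntegral_congr_fun (g := fun x => exp (-((k + 1) * x))) measurableSet_Ioi
      fun x hx => by
        simp only [max_eq_left (mem_Ioi.1 hx).le, ← exp_add]; congr 1; ring,
    integral_exp_neg_mul_Ioi (by linarith), setIntegral_const, stdExp_real_Iic ht,
    show -((k + 1) * t) = -(k * t) + -t by ring, exp_add, smul_eq_mul]
  field_simp
  ring

lemma integral_exp_neg_mul {k : ℝ} (hk : 0 ≤ k) :
    ∫ x, exp (-(k * x)) ∂stdExp = 1 / (k + 1) := by
  have h := integral_exp_neg_mul_Ioi (by linarith : 0 < k + 1) 0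
  rw [mul_zero, neg_zero, exp_zero] at h
  rw [integral_stdExp, ← h]
  refine integral_congr_ae (.of_forall fun x => ?_)
  simp only [← exp_add]; congr 1; ring

lemma integral_ite_gt {t : ℝ} (ht : 0 ≤ t) :
    ∫ x, (if t < x then (1:ℝ) else 0) ∂stdExp = exp (-t) := by
  rw [← stdExp_real_Ioi ht, ← integral_indicator_one measurableSet_Ioi]
  simp [indicator_apply]

lemma integral_ite_lt {t : ℝ} (ht : 0 ≤ t) :
    ∫ x, (if x < t then (1:ℝ) else 0) ∂stdExp = 1 - exp (-t) := by
  rw [← stdExp_real_Iic ht, ← measureReal_congr Iio_ae_eq_Iic,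
    ← integral_indicator_one measurableSet_Iio]
  simp [indicator_apply]

/-- The product of three standard exponential distributions. -/
noncomputable def stdExp₃ : Measure (ℝ × ℝ × ℝ) := stdExp.prod (stdExp.prod stdExp)

instance : IsProbabilityMeasure stdExp₃ := by unfold stdExp₃; infer_instance

lemma integral_stdExp₃ {f : ℝ × ℝ × ℝ → ℝ} (hf : Integrable f stdExp₃) :
    ∫ p, f p ∂stdExp₃ = ∫ x, ∫ y, ∫ z, f (x, y, z) ∂stdExp ∂stdExp ∂stdExp := by
  unfold stdExp₃ at hf ⊢
  rw [integral_prod _ hf]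
  refine integral_congr_ae ?_
  filter_upwards [hf.prod_right_ae] with x hx
  exact integral_prod _ hx

/-- The function `f` of three independent standard exponential variables is integrable, with
expectation `a`. -/
def HasExpectation (f : ℝ × ℝ × ℝ → ℝ) (a : ℝ) : Prop :=
  Integrable f stdExp₃ ∧ ∫ p, f p ∂stdExp₃ = a

namespace HasExpectation

variable {f g : ℝ × ℝ × ℝ → ℝ} {a b : ℝ}

lemma add (hf : HasExpectation f a) (hg : HasExpectation g b) :
    HasExpectation (fun p => f p + g p) (a + b) :=
  ⟨hf.1.add hg.1, by rw [integral_add hf.1 hg.1, hf.2, hg.2]⟩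

lemma sub (hf : HasExpectation f a) (hg : HasExpectation g b) :
    HasExpectation (fun p => f p - g p) (a - b) :=
  ⟨hf.1.sub hg.1, by rw [integral_sub hf.1 hg.1, hf.2, hg.2]⟩

lemma const_mul (hf : HasExpectation f a) (c : ℝ) :
    HasExpectation (fun p => c * f p) (c * a) :=
  ⟨hf.1.const_mul c, by rw [integral_const_mul, hf.2]⟩

lemma comp_equiv (hf : HasExpectation f a) (e : ℝ × ℝ × ℝ ≃ᵐ ℝ × ℝ × ℝ)
    (he : MeasurePreserving e stdExp₃ stdExp₃) : HasExpectation (fun p => f (e p)) a :=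
  ⟨he.integrable_comp_emb e.measurableEmbedding |>.2 hf.1,
    (he.integral_comp e.measurableEmbedding f).trans hf.2⟩

lemma swap_right (hf : HasExpectation f a) : HasExpectation (fun p => f (p.1, p.2.2, p.2.1)) a :=
  hf.comp_equiv ((MeasurableEquiv.refl ℝ).prodCongr MeasurableEquiv.prodComm)
    ((MeasurePreserving.id stdExp).prod Measure.measurePreserving_swap)

lemma rotate (hf : HasExpectation f a) : HasExpectation (fun p => f (p.2.1, p.2.2, p.1)) a :=
  hf.comp_equiv (MeasurableEquiv.prodComm.trans MeasurableEquiv.prodAssoc)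
    ((measurePreserving_prodAssoc stdExp stdExp stdExp).comp Measure.measurePreserving_swap)

end HasExpectation

lemma sum_perm_fin_four (F : Fin 4 → Fin 4 → Fin 4 → Fin 4 → ℝ) :
    ∑ σ : Equiv.Perm (Fin 4), F (σ 0) (σ 1) (σ 2) (σ 3) =
      F 0 1 2 3 + F 1 0 2 3 + F 0 2 1 3 + F 2 0 1 3 + F 1 2 0 3 + F 2 1 0 3
      + (F 0 1 3 2 + F 1 0 3 2 + F 0 3 1 2 + F 3 0 1 2 + F 1 3 0 2 + F 3 1 0 2)
      + (F 0 2 3 1 + F 2 0 3 1 + F 0 3 2 1 + F 3 0 2 1 + F 2 3 0 1 + F 3 2 0 1)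
      + (F 1 2 3 0 + F 2 1 3 0 + F 1 3 2 0 + F 3 1 2 0 + F 2 3 1 0 + F 3 2 1 0) := by
  let e (σ : Equiv.Perm (Fin 4)) := (σ 0, σ 1, σ 2, σ 3)
  have h : Finset.univ.image e = ({t | t.1 ≠ t.2.1 ∧ t.1 ≠ t.2.2.1 ∧ t.1 ≠ t.2.2.2 ∧
      t.2.1 ≠ t.2.2.1 ∧ t.2.1 ≠ t.2.2.2 ∧ t.2.2.1 ≠ t.2.2.2} : Finset _) := by
    decide +kernel
  have he : Function.Injective e := fun σ τ h => by
    simp only [e, Prod.mk.injEq] at h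
    ext i; fin_cases i <;> simp [h]
  rw [← Finset.sum_image (f := fun t => F t.1 t.2.1 t.2.2.1 t.2.2.2) (g := e) he.injOn, h,
    Finset.sum_filter]
  simp [Fintype.sum_prod_type, Fin.sum_univ_four]
  ring

/-- Indicator that the larger of the first two entries plus a third of the third one is below
the fourth one. -/
noncomputable def scaledInd (a b c d : ℝ) : ℝ := if max a b + c / 3 < d then 1 else 0

/-- Indicator that the fourth entry is larger than the other three. -/
noncomputable def maxInd (a b c d : ℝ) : ℝ := if max (max a b) c < d then 1 else 0

lemma scaledInd_comm (a b c d : ℝ) : scaledInd b a c d = scaledInd a b c d := by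
  simp [scaledInd, max_comm]

lemma integrable_scaledInd {a b c d : ℝ × ℝ × ℝ → ℝ} (ha : Measurable a) (hb : Measurable b)
    (hc : Measurable c) (hd : Measurable d) :
    Integrable (fun p => scaledInd (a p) (b p) (c p) (d p)) stdExp₃ := by
  refine Integrable.of_bound (Measurable.aestronglyMeasurable ?_) 1 (.of_forall fun p => ?_)
  · exact Measurable.ite (measurableSet_lt (by fun_prop) hd) measurable_const measurable_const
  · unfold scaledInd; split_ifs <;> simp

lemma integrable_maxInd {a b c d : ℝ × ℝ × ℝ → ℝ} (ha : Measurable a) (hb : Measurable b)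
    (hc : Measurable c) (hd : Measurable d) :
    Integrable (fun p => maxInd (a p) (b p) (c p) (d p)) stdExp₃ := by
  refine Integrable.of_bound (Measurable.aestronglyMeasurable ?_) 1 (.of_forall fun p => ?_)
  · exact Measurable.ite (measurableSet_lt (by fun_prop) hd) measurable_const measurable_const
  · unfold maxInd; split_ifs <;> simp

lemma hasExpectation_maxInd_const {s : ℝ} (hs : 0 ≤ s) :
    HasExpectation (fun p => maxInd p.1 p.2.1 p.2.2 s)
      ((1 - exp (-s)) ^ 3) := by
  have hi : Integrable (fun p : ℝ × ℝ × ℝ => maxInd p.1 p.2.1 p.2.2 s) stdExp₃ :=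
    integrable_maxInd (by fun_prop) (by fun_prop) (by fun_prop) (by fun_prop)
  refine ⟨hi, ?_⟩
  rw [integral_stdExp₃ hi]
  have h (x y z : ℝ) : maxInd x y z s = (if x < s then (1:ℝ) else 0) *
      ((if y < s then (1:ℝ) else 0) * (if z < s then (1:ℝ) else 0)) := by
    simp only [maxInd, max_lt_iff]; split_ifs <;> simp_all
  simp only [h, integral_const_mul, integral_mul_const, integral_ite_lt hs]
  ring

lemma hasExpectation_maxInd_last {s : ℝ} (hs : 0 ≤ s) :
    HasExpectation (fun p => maxInd p.1 p.2.1 s p.2.2)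
      (exp (-s) - exp (-(2 * s)) + exp (-(3 * s)) / 3) := by
  have hi : Integrable (fun p : ℝ × ℝ × ℝ => maxInd p.1 p.2.1 s p.2.2) stdExp₃ :=
    integrable_maxInd (by fun_prop) (by fun_prop) (by fun_prop) (by fun_prop)
  refine ⟨hi, ?_⟩
  rw [integral_stdExp₃ hi]
  have hz (x y : ℝ) : ∫ z, maxInd x y s z ∂stdExp = exp (-(1 * max y (max x s))) := by
    rw [one_mul, max_left_comm, ← max_assoc]
    exact integral_ite_gt (hs.trans (le_max_right _ _))
  have hm (x : ℝ) : 0 ≤ max x s := hs.trans (le_max_right _ _)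
  simp only [hz, integral_exp_neg_mul_max zero_le_one (hm _)]
  norm_num only
  rw [integral_sub (integrable_exp_neg_mul_max zero_le_one hs)
    ((integrable_exp_neg_mul_max zero_le_two hs).const_mul _), integral_const_mul,
    integral_exp_neg_mul_max zero_le_one hs, integral_exp_neg_mul_max zero_le_two hs]
  norm_num
  ring

lemma hasExpectation_scaledInd_third {s : ℝ} (hs : 0 ≤ s) :
    HasExpectation (fun p => scaledInd p.1 p.2.1 s p.2.2)
      (exp (-(s / 3)) / 3) := by
  have hi : Integrable (fun p : ℝ × ℝ × ℝ => scaledInd p.1 p.2.1 s p.2.2) stdExp₃ :=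
    integrable_scaledInd (by fun_prop) (by fun_prop) (by fun_prop) (by fun_prop)
  refine ⟨hi, ?_⟩
  rw [integral_stdExp₃ hi]
  have hy (x : ℝ) (hx : 0 < x) : ∫ y, ∫ z, scaledInd x y s z ∂stdExp ∂stdExp =
      (exp (-(1 * x)) - 1 / 2 * exp (-(2 * x))) * exp (-(s / 3)) := by
    have hz (y : ℝ) : ∫ z, scaledInd x y s z ∂stdExp =
        exp (-(1 * max y x)) * exp (-(s / 3)) := by
      rw [← exp_add, one_mul, ← neg_add, max_comm]
      exact integral_ite_gt (by have := le_max_left x y; linarith)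
    simp only [hz, integral_mul_const, integral_exp_neg_mul_max zero_le_one hx.le]
    norm_num
  have hk {k : ℝ} (h0 : 0 ≤ k) : Integrable (fun x => exp (-(k * x))) stdExp :=
    .of_integral_ne_zero (by rw [integral_exp_neg_mul h0]; positivity)
  rw [integral_congr_ae (ae_stdExp_pos.mono hy), integral_mul_const, integral_sub (hk zero_le_one)
    ((hk zero_le_two).const_mul _), integral_const_mul, integral_exp_neg_mul zero_le_one,
    integral_exp_neg_mul zero_le_two]
  ring

lemma hasExpectation_scaledInd_first {s : ℝ} (hs : 0 ≤ s) :
    HasExpectation (fun p => scaledInd s p.1 p.2.1 p.2.2)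
      (3 / 4 * (exp (-s) - exp (-(2 * s)) / 2)) := by
  have hi : Integrable (fun p : ℝ × ℝ × ℝ => scaledInd s p.1 p.2.1 p.2.2) stdExp₃ :=
    integrable_scaledInd (by fun_prop) (by fun_prop) (by fun_prop) (by fun_prop)
  refine ⟨hi, ?_⟩
  rw [integral_stdExp₃ hi]
  have hy (x : ℝ) : ∫ y, ∫ z, scaledInd s x y z ∂stdExp ∂stdExp =
      exp (-(1 * max x s)) * (3 / 4) := by
    have hz (y : ℝ) (hy : 0 < y) : ∫ z, scaledInd s x y z ∂stdExp =
        exp (-(1 * max x s)) * exp (-(1 / 3 * y)) := by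
      rw [← exp_add, one_mul, ← neg_add, max_comm, one_div_mul_eq_div]
      exact integral_ite_gt (by have := le_max_left s x; linarith)
    rw [integral_congr_ae (ae_stdExp_pos.mono hz), integral_const_mul,
      integral_exp_neg_mul (by norm_num)]
    norm_num
  simp only [hy, integral_mul_const, integral_exp_neg_mul_max zero_le_one hs]
  norm_num
  ring

lemma hasExpectation_scaledInd_const {s : ℝ} (hs : 0 ≤ s) :
    HasExpectation (fun p => scaledInd p.2.1 p.2.2 p.1 s)
      ((1 - exp (-s)) ^ 3) := by
  have hi : Integrable (fun p : ℝ × ℝ × ℝ => scaledInd p.2.1 p.2.2 p.1 s) stdExp₃ :=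
    integrable_scaledInd (by fun_prop) (by fun_prop) (by fun_prop) (by fun_prop)
  refine ⟨hi, ?_⟩
  rw [integral_stdExp₃ hi]
  have h (x y z : ℝ) : scaledInd y z x s = (if y < s - x / 3 then (1:ℝ) else 0) *
      (if z < s - x / 3 then (1:ℝ) else 0) := by
    simp only [scaledInd, ← lt_sub_iff_add_lt, max_lt_iff]; split_ifs <;> simp_all
  have hx (x : ℝ) : (∫ y, (if y < s - x / 3 then (1:ℝ) else 0) ∂stdExp) *
      (∫ y, (if y < s - x / 3 then (1:ℝ) else 0) ∂stdExp) * exp (-x) =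
      (Iio (3 * s)).indicator
        (fun x => exp (-x) - 2 * exp (-s) * exp (-(2 / 3 * x))
          + exp (-s) ^ 2 * exp (-(1 / 3 * x))) x := by
    by_cases hx : x < 3 * s
    · rw [indicator_of_mem (mem_Iio.2 hx), integral_ite_lt (by linarith),
        show -(s - x / 3) = -s + 1 / 3 * x by ring,
        show -x = -(1 / 3 * x) + (-(1 / 3 * x) + -(1 / 3 * x)) by ring,
        show -(2 / 3 * x) = -(1 / 3 * x) + -(1 / 3 * x) by ring]
      simp only [exp_add, exp_neg (1 / 3 * x)]
      field_simp
      ring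
    · rw [indicator_of_notMem (by simpa using hx), integral_congr_ae (g := fun _ => 0)
        (ae_stdExp_pos.mono fun y hy => if_neg (by linarith))]
      simp
  simp only [h, integral_const_mul, integral_mul_const]
  rw [integral_stdExp]
  simp only [hx]
  rw [setIntegral_indicator measurableSet_Iio, Ioi_inter_Iio, ← integral_Ioc_eq_integral_Ioo,
    ← intervalIntegral.integral_of_le (by linarith),
    intervalIntegral.integral_eq_sub_of_hasDerivAt (f := fun x => -exp (-x)
      + 3 * exp (-s) * exp (-(2 / 3 * x)) - 3 * exp (-s) ^ 2 * exp (-(1 / 3 * x)))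
      (fun x _ => ?_) (by apply Continuous.intervalIntegrable; fun_prop)]
  · rw [show -(3 * s) = -s + -s + -s by ring, show -(2 / 3 * (3 * s)) = -s + -s by ring,
      show -(1 / 3 * (3 * s)) = -s by ring]
    simp only [exp_add, mul_zero, neg_zero, exp_zero]
    ring
  · have h (c : ℝ) : HasDerivAt (fun x => exp (-(c * x))) (exp (-(c * x)) * (-(c * 1))) x :=
      (((hasDerivAt_id x).const_mul c).neg).exp
    have h1 := h 1
    simp only [one_mul] at h1
    refine ((h1.neg.add ((h (2/3)).const_mul (3 * exp (-s)))).sub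
      ((h (1/3)).const_mul (3 * exp (-s) ^ 2))).congr_deriv ?_
    ring

lemma PsiKernel_eq (x y z s : ℝ) : PsiKernel x y z s =
    1 / 4 * (maxInd y z s x + maxInd x z s y + maxInd x y s z + maxInd x y z s)
    - 1 / 12 * ((scaledInd y z x s + scaledInd x z y s + scaledInd x y z s)
      + (scaledInd x y s z + scaledInd x z s y + scaledInd y z s x)
      + (scaledInd s x y z + scaledInd s x z y + scaledInd s y x z
        + scaledInd s y z x + scaledInd s z x y + scaledInd s z y x)) := by
  let v : Fin 4 → ℝ := ![x, y, z, s]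
  have h := sum_perm_fin_four fun i j k l => scaledInd (v i) (v j) (v k) (v l)
  have hP : PsiKernel x y z s =
      1 / 4 * (maxInd y z s x + maxInd x z s y + maxInd x y s z + maxInd x y z s)
      - 1 / 24 * ∑ σ : Equiv.Perm (Fin 4), scaledInd (v (σ 0)) (v (σ 1)) (v (σ 2)) (v (σ 3)) := rfl
  rw [hP, h]
  simp only [show v 0 = x from rfl, show v 1 = y from rfl, show v 2 = z from rfl,
    show v 3 = s from rfl, scaledInd_comm x y, scaledInd_comm x z, scaledInd_comm y z,
    scaledInd_comm x s, scaledInd_comm y s, scaledInd_comm z s]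
  ring

lemma hasExpectation_PsiKernel {s : ℝ} (hs : 0 ≤ s) :
    HasExpectation (fun p => PsiKernel p.1 p.2.1 p.2.2 s) (psi s) := by
  have hl := hasExpectation_maxInd_last hs
  have ht := hasExpectation_scaledInd_third hs
  have hf := hasExpectation_scaledInd_first hs
  have hc := hasExpectation_scaledInd_const hs
  have H := ((((hl.rotate.add hl.swap_right).add hl).add
    (hasExpectation_maxInd_const hs)).const_mul (1 / 4)).sub
    ((((hc.add hc.swap_right.rotate).add hc.rotate.rotate).add
      ((ht.add ht.swap_right).add ht.rotate)).add
      (((((hf.add hf.swap_right).add hf.swap_right.rotate).add hf.rotate).add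
        hf.rotate.rotate).add hf.rotate.swap_right) |>.const_mul (1 / 12))
  simp only [PsiKernel_eq]
  refine ⟨H.1, H.2.trans ?_⟩
  rw [psi, show -s / 3 = -(s / 3) by ring, show -3 * s = -s + -s + -s by ring,
    show -(3 * s) = -s + -s + -s by ring, show -2 * s = -s + -s by ring,
    show -(2 * s) = -s + -s by ring]
  simp only [exp_add]
  ring

/-- For `X₁, X₂, X₃` i.i.d. standard exponential, the conditional expectation of
`Ψ(X₁,X₂,X₃,X₄)` given `X₄ = s` equals `ψ(s)`. -/
theorem projection_of_kernel_Psi (s : ℝ) (hs : 0 ≤ s) :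
    ∫ x in Set.Ioi (0:ℝ), ∫ y in Set.Ioi (0:ℝ), ∫ z in Set.Ioi (0:ℝ),
      PsiKernel x y z s * exp (-(x + y + z)) = psi s := by
  have H := hasExpectation_PsiKernel hs
  rw [← H.2, integral_stdExp₃ H.1, integral_stdExp]
  simp only [integral_stdExp, ← integral_mul_const]
  refine integral_congr_ae (.of_forall fun x => integral_congr_ae (.of_forall fun y =>
    integral_congr_ae (.of_forall fun z => ?_)))
  simp only [neg_add, exp_add]
  ring
end

section
/- For the Weibull alternative, whose density derivative at θ = 0 is h_2(x) = e^{-x}(1 + ln x − x ln x), one has 4 ∫_0^∞ ψ(x) h_2(x) dx = (7/16) ln 3 − (5/8) ln 2. -/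
open Real MeasureTheory

/-- Derivative at `θ = 0` of the Weibull density `g₂(x,θ) = (1+θ) x^θ exp(−x^{1+θ})`. -/
noncomputable def h2 (x : ℝ) : ℝ := exp (-x) * (1 + Real.log x - x * Real.log x)

open Set Filter Topology

lemma Real.abs_log_le_two_mul_rpow_add {x : ℝ} (hx : 0 < x) :
    |log x| ≤ 2 * x ^ (-(1 / 2) : ℝ) + x := by
  have hpow : 0 < x ^ (-(1 / 2) : ℝ) := rpow_pos_of_pos hx _
  have hlog := log_le_sub_one_of_pos hpow
  rw [log_rpow hx] at hlog
  rw [abs_le]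
  constructor
  · linarith
  · linarith [log_le_sub_one_of_pos hx]

lemma integrableOn_rpow_mul_exp_neg_mul {s b : ℝ} (hs : -1 < s) (hb : 0 < b) :
    IntegrableOn (fun x : ℝ => x ^ s * exp (-b * x)) (Ioi 0) := by
  simpa using integrableOn_rpow_mul_exp_neg_mul_rpow hs one_pos hb

lemma integrableOn_rpow_mul_exp_neg_mul_mul_log {s b : ℝ} (hs : -(1 / 2) < s) (hb : 0 < b) :
    IntegrableOn (fun x : ℝ => x ^ s * exp (-b * x) * log x) (Ioi 0) := by
  have hbound : IntegrableOn (fun x : ℝ => 2 * (x ^ (s + -(1 / 2)) * exp (-b * x)) +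
      x ^ (s + 1) * exp (-b * x)) (Ioi 0) :=
    ((integrableOn_rpow_mul_exp_neg_mul (by linarith) hb).const_mul 2).add
      (integrableOn_rpow_mul_exp_neg_mul (by linarith) hb)
  refine hbound.mono' (by fun_prop) ?_
  filter_upwards [ae_restrict_mem measurableSet_Ioi] with x (hx : 0 < x)
  have hpos : 0 < x ^ s * exp (-b * x) := mul_pos (rpow_pos_of_pos hx _) (exp_pos _)
  rw [norm_mul, norm_of_nonneg hpos.le, norm_eq_abs, rpow_add hx, rpow_add hx, rpow_one]
  calc x ^ s * exp (-b * x) * |log x|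
      ≤ x ^ s * exp (-b * x) * (2 * x ^ (-(1 / 2) : ℝ) + x) := by
        gcongr; exact abs_log_le_two_mul_rpow_add hx
    _ = _ := by ring

lemma integrableOn_exp_neg_mul_mul_log {b : ℝ} (hb : 0 < b) :
    IntegrableOn (fun x : ℝ => exp (-b * x) * log x) (Ioi 0) := by
  simpa using integrableOn_rpow_mul_exp_neg_mul_mul_log (s := 0) (by norm_num) hb

lemma integrableOn_mul_exp_neg_mul_mul_log {b : ℝ} (hb : 0 < b) :
    IntegrableOn (fun x : ℝ => x * exp (-b * x) * log x) (Ioi 0) := by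
  simpa using integrableOn_rpow_mul_exp_neg_mul_mul_log (s := 1) (by norm_num) hb

lemma integral_exp_neg_mul_Ioi_zero {b : ℝ} (hb : 0 < b) :
    ∫ x in Ioi (0 : ℝ), exp (-b * x) = 1 / b := by
  rw [integral_exp_mul_Ioi (neg_neg_of_pos hb)]
  simp

lemma integral_exp_neg_mul_mul_log {b : ℝ} (hb : 0 < b) :
    ∫ x in Ioi (0 : ℝ), exp (-b * x) * log x =
      ((∫ x in Ioi (0 : ℝ), exp (-x) * log x) - log b) / b := by
  have hscale := integral_comp_mul_left_Ioi (fun x => exp (-x) * log x) 0 hb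
  have hsplit : ∫ x in Ioi (0 : ℝ), exp (-(b * x)) * log (b * x) =
      ∫ x in Ioi (0 : ℝ), (log b * exp (-b * x) + exp (-b * x) * log x) := by
    refine setIntegral_congr_fun measurableSet_Ioi fun x (hx : 0 < x) => ?_
    simp only [log_mul hb.ne' hx.ne', neg_mul]
    ring
  rw [hsplit, integral_add ((integrableOn_exp_mul_Ioi (neg_neg_of_pos hb) 0).const_mul _)
    (integrableOn_exp_neg_mul_mul_log hb), integral_const_mul,
    integral_exp_neg_mul_Ioi_zero hb, mul_zero, smul_eq_mul] at hscale
  rw [eq_sub_of_add_eq' hscale]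
  ring

lemma tendsto_mul_log_mul_exp_neg_mul_atTop {b : ℝ} (hb : 0 < b) :
    Tendsto (fun x : ℝ => x * log x * exp (-b * x)) atTop (𝓝 0) := by
  refine squeeze_zero' ?_ ?_ (tendsto_rpow_mul_exp_neg_mul_atTop_nhds_zero 2 b hb)
  · filter_upwards [eventually_ge_atTop 1] with x hx
    have := log_nonneg hx
    positivity
  · filter_upwards [eventually_ge_atTop 1] with x hx
    rw [rpow_two, sq]
    gcongr
    exact log_le_self (by linarith)

/-- Integration by parts: the integrand is the derivative of `x * log x * exp (-b * x)`. -/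
lemma integral_mul_exp_neg_mul_mul_log {b : ℝ} (hb : 0 < b) :
    ∫ x in Ioi (0 : ℝ), x * exp (-b * x) * log x =
      (1 / b + ∫ x in Ioi (0 : ℝ), exp (-b * x) * log x) / b := by
  have hexp := integrableOn_exp_mul_Ioi (neg_neg_of_pos hb) 0
  have hlog := integrableOn_exp_neg_mul_mul_log hb
  have hmul := (integrableOn_mul_exp_neg_mul_mul_log hb).const_mul b
  have hderiv : ∀ x ∈ Ioi (0 : ℝ), HasDerivAt (fun x : ℝ => x * log x * exp (-b * x))
      (exp (-b * x) + exp (-b * x) * log x - b * (x * exp (-b * x) * log x)) x := by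
    intro x hx
    convert! (hasDerivAt_mul_log (ne_of_gt hx)).mul
      ((hasDerivAt_id x).const_mul (-b)).exp using 1
    simp only [id_eq]
    ring
  have hparts := integral_Ioi_of_hasDerivAt_of_tendsto
    (continuous_mul_log.fun_mul (by fun_prop)).continuousWithinAt hderiv
    ((hexp.add hlog).sub hmul) (tendsto_mul_log_mul_exp_neg_mul_atTop hb)
  rw [integral_sub (hexp.fun_add hlog) hmul, integral_add hexp hlog, integral_const_mul,
    integral_exp_neg_mul_Ioi_zero hb] at hparts
  rw [eq_div_iff hb.ne']
  simp only [zero_mul, sub_zero] at hparts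
  linarith

lemma exp_neg_mul_mul_h2 (a x : ℝ) :
    exp (-a * x) * h2 x = exp (-(a + 1) * x) + exp (-(a + 1) * x) * log x -
      x * exp (-(a + 1) * x) * log x := by
  rw [show -(a + 1) * x = -a * x + -x by ring, exp_add, h2]
  ring

lemma integrableOn_exp_neg_mul_mul_h2 {a : ℝ} (ha : 0 ≤ a) :
    IntegrableOn (fun x => exp (-a * x) * h2 x) (Ioi 0) := by
  have hb : 0 < a + 1 := by linarith
  simp only [exp_neg_mul_mul_h2]
  exact ((integrableOn_exp_mul_Ioi (neg_neg_of_pos hb) 0).add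
    (integrableOn_exp_neg_mul_mul_log hb)).sub (integrableOn_mul_exp_neg_mul_mul_log hb)

/-- The Laplace transform of `h2`, in terms of the constant `∫ exp (-x) * log x`. -/
lemma integral_exp_neg_mul_mul_h2 {a : ℝ} (ha : 0 ≤ a) :
    ∫ x in Ioi (0 : ℝ), exp (-a * x) * h2 x =
      a / (a + 1) ^ 2 * (1 + (∫ x in Ioi (0 : ℝ), exp (-x) * log x) - log (a + 1)) := by
  have hb : 0 < a + 1 := by linarith
  have hexp := integrableOn_exp_mul_Ioi (neg_neg_of_pos hb) 0
  have hlog := integrableOn_exp_neg_mul_mul_log hb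
  simp only [exp_neg_mul_mul_h2]
  rw [integral_sub (hexp.fun_add hlog) (integrableOn_mul_exp_neg_mul_mul_log hb),
    integral_add hexp hlog, integral_mul_exp_neg_mul_mul_log hb,
    integral_exp_neg_mul_mul_log hb, integral_exp_neg_mul_Ioi_zero hb]
  field_simp
  ring

/-- For the Weibull alternative, `4 ∫_0^∞ ψ(x) h₂(x) dx = (7/16) ln 3 − (5/8) ln 2`. -/
theorem weibull_local_slope_coefficient :
    4 * ∫ x in Set.Ioi (0:ℝ), psi x * h2 x = (7/16) * Real.log 3 - (5/8) * Real.log 2 := by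
  have hterm (c a : ℝ) (ha : 0 ≤ a) :
      IntegrableOn (fun x => c * (exp (-a * x) * h2 x)) (Ioi 0) :=
    (integrableOn_exp_neg_mul_mul_h2 ha).const_mul c
  have hpsi (x : ℝ) : psi x * h2 x = 3 / 8 * (exp (-1 * x) * h2 x) -
      9 / 16 * (exp (-2 * x) * h2 x) + 1 / 4 * (exp (-3 * x) * h2 x) -
      1 / 12 * (exp (-(1 / 3) * x) * h2 x) := by
    rw [psi, show -x / 3 = -(1 / 3) * x by ring, neg_one_mul]
    ring
  have hterm_one := hterm (3 / 8) 1 (by norm_num)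
  have hterm_two := hterm (9 / 16) 2 (by norm_num)
  have hterm_three := hterm (1 / 4) 3 (by norm_num)
  have hterm_third := hterm (1 / 12) (1 / 3) (by norm_num)
  simp only [hpsi]
  rw [integral_sub ((hterm_one.fun_sub hterm_two).fun_add hterm_three) hterm_third,
    integral_add (hterm_one.fun_sub hterm_two) hterm_three, integral_sub hterm_one hterm_two]
  simp only [integral_const_mul]
  rw [integral_exp_neg_mul_mul_h2 zero_le_one, integral_exp_neg_mul_mul_h2 zero_le_two,
    integral_exp_neg_mul_mul_h2 zero_le_three,
    integral_exp_neg_mul_mul_h2 (a := 1 / 3) (by norm_num)]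
  have hlog4 : log 4 = 2 * log 2 := by
    rw [show (4 : ℝ) = 2 ^ 2 by norm_num, log_pow]; norm_num
  have hlog43 : log (4 / 3) = 2 * log 2 - log 3 := by
    rw [log_div (by norm_num) (by norm_num), hlog4]
  norm_num [hlog4, hlog43]
  ring
end

section
/- For the Lehmann alternative, whose density derivative at θ = 0 is h_3(x) = e^{-x}(1 + ln(1 − e^{-x})), one has 4 ∫_0^∞ ψ(x) h_3(x) dx = 2/3 − (3/8) ln 3 − (√3/24) π. -/
open Real MeasureTheory

/-- Derivative at `θ = 0` of the Lehmann density `g₃(x,θ) = (1+θ)(1−e^{-x})^θ e^{-x}`. -/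
noncomputable def h3 (x : ℝ) : ℝ := exp (-x) * (1 + Real.log (1 - exp (-x)))

/-- The function `(1 - t³) log (1 - t³)`, extended continuously by `0` at `t = 1`. -/
noncomputable def cubeEntropy (t : ℝ) : ℝ := (1 - t ^ 3) * Real.log (1 - t ^ 3)

lemma continuous_cubeEntropy : Continuous cubeEntropy :=
  Real.continuous_mul_log.comp (by fun_prop : Continuous fun t : ℝ => 1 - t ^ 3)

lemma hasDerivAt_cubeEntropy {t : ℝ} (ht : 1 - t ^ 3 ≠ 0) :
    HasDerivAt cubeEntropy (-3 * t ^ 2 * (1 + Real.log (1 - t ^ 3))) t := by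
  have h : HasDerivAt (fun t : ℝ => 1 - t ^ 3) (-(3 * t ^ 2)) t := by
    simpa using (hasDerivAt_pow 3 t).const_sub 1
  refine ((Real.hasDerivAt_mul_log ht).comp t h).congr_deriv ?_
  ring

lemma exp_neg_div_three_pow (x : ℝ) (n : ℕ) : exp (-x / 3) ^ n = exp (-(n / 3) * x) := by
  rw [← Real.exp_nat_mul]
  congr 1
  ring

lemma hasDerivAt_exp_neg_div_three (x : ℝ) :
    HasDerivAt (fun x : ℝ => exp (-x / 3)) (-exp (-x / 3) / 3) x := by
  refine ((hasDerivAt_neg x).div_const 3).exp.congr_deriv ?_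
  ring

lemma tendsto_exp_neg_div_three :
    Filter.Tendsto (fun x : ℝ => exp (-x / 3)) Filter.atTop (nhds 0) := by
  refine Real.tendsto_exp_atBot.comp ?_
  exact Filter.Tendsto.atBot_div_const (by norm_num) Filter.tendsto_neg_atTop_atBot

lemma exp_neg_eq_pow (x : ℝ) : exp (-x) = exp (-x / 3) ^ 3 := by
  rw [exp_neg_div_three_pow]
  norm_num

lemma exp_neg_div_three_lt_one {x : ℝ} (hx : 0 < x) : exp (-x / 3) < 1 := by
  rw [Real.exp_lt_one_iff]
  linarith

lemma one_sub_pow_three_pos {t : ℝ} (ht : t < 1) : 0 < 1 - t ^ 3 := by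
  nlinarith [mul_pos (sub_pos.2 ht) (by nlinarith [sq_nonneg (t + 1 / 2)] : 0 < t ^ 2 + t + 1)]

lemma h3_eq (x : ℝ) :
    h3 x = exp (-x / 3) ^ 3 * (1 + Real.log (1 - exp (-x / 3) ^ 3)) := by
  rw [h3, exp_neg_eq_pow]

lemma psi_eq (x : ℝ) :
    psi x = (3 / 8) * exp (-x / 3) ^ 3 - (9 / 16) * exp (-x / 3) ^ 6
      + (1 / 4) * exp (-x / 3) ^ 9 - (1 / 12) * exp (-x / 3) := by
  rw [psi, exp_neg_div_three_pow, exp_neg_div_three_pow, exp_neg_div_three_pow]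
  norm_num

lemma integrableOn_h3 : IntegrableOn h3 (Set.Ioi 0) := by
  have hexp : IntegrableOn (fun x : ℝ => exp (-x)) (Set.Ioi 0) := integrableOn_exp_neg_Ioi 0
  have hlog : IntegrableOn (fun x : ℝ => exp (-x) - h3 x) (Set.Ioi 0) := by
    have hcont : Continuous fun t : ℝ => -t ^ 3 - cubeEntropy t := by
      have := continuous_cubeEntropy
      fun_prop
    refine integrableOn_Ioi_deriv_of_nonneg
      (g := fun x : ℝ => -exp (-x / 3) ^ 3 - cubeEntropy (exp (-x / 3)))
      (hcont.comp (by fun_prop : Continuous fun x : ℝ => exp (-x / 3))).continuousWithinAt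
      (fun x hx => ?_) (fun x hx => ?_)
      ((hcont.tendsto 0).comp tendsto_exp_neg_div_three)
    · have hpos := one_sub_pow_three_pos (exp_neg_div_three_lt_one hx)
      have ht := hasDerivAt_exp_neg_div_three x
      refine ((ht.pow 3).neg.sub
        ((hasDerivAt_cubeEntropy hpos.ne').comp x ht)).congr_deriv ?_
      rw [h3_eq, exp_neg_eq_pow]
      push_cast
      ring
    · have hpos := one_sub_pow_three_pos (exp_neg_div_three_lt_one hx)
      have ht := Real.exp_pos (-x / 3)
      have hl : Real.log (1 - exp (-x / 3) ^ 3) ≤ 0 :=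
        Real.log_nonpos hpos.le (by linarith [pow_pos ht 3])
      rw [h3_eq, exp_neg_eq_pow]
      nlinarith [mul_nonneg (pow_pos ht 3).le (neg_nonneg.2 hl)]
  exact (hexp.sub hlog).congr (Filter.Eventually.of_forall fun x => by simp)

lemma integrableOn_psi_mul_h3 : IntegrableOn (fun x => psi x * h3 x) (Set.Ioi 0) := by
  refine Integrable.bdd_mul (c := 2) integrableOn_h3 ?_ ?_
  · have : Continuous psi := by
      unfold psi
      fun_prop
    exact this.aestronglyMeasurable
  · refine (ae_restrict_iff' measurableSet_Ioi).2 (Filter.Eventually.of_forall fun x hx => ?_)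
    have h0 := (Real.exp_pos (-x / 3)).le
    have h1 := (exp_neg_div_three_lt_one hx).le
    rw [psi_eq, Real.norm_eq_abs, abs_le]
    have := pow_nonneg h0 3
    have := pow_nonneg h0 6
    have := pow_nonneg h0 9
    have := pow_le_one₀ h0 h1 (n := 3)
    have := pow_le_one₀ h0 h1 (n := 6)
    have := pow_le_one₀ h0 h1 (n := 9)
    constructor <;> linarith

/-- An antiderivative of `psi * h3` on `(0, ∞)`, in the variable `t = exp (-x / 3)`. -/
noncomputable def slopePrimitive (t : ℝ) : ℝ :=
  -(1 / 16) * (3 * t ^ 6 - 3 * t ^ 9 + t ^ 12 - t ^ 4)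
    - (1 / 16) * (t ^ 3 * (1 / (t ^ 2 + t + 1) - (1 - t ^ 3) ^ 2)) * cubeEntropy t
    - (3 / 16) * (t ^ 4 / 4 - t ^ 3 / 3 + t - Real.log (t ^ 2 + t + 1) / 2
      - Real.arctan ((2 * t + 1) / √3) / √3 - (t ^ 6 / 6 - 2 * t ^ 9 / 9 + t ^ 12 / 12))

lemma sq_add_self_add_one_pos (t : ℝ) : 0 < t ^ 2 + t + 1 := by
  nlinarith [sq_nonneg (t + 1 / 2)]

lemma continuous_slopePrimitive : Continuous slopePrimitive := by
  have h := fun t => (sq_add_self_add_one_pos t).ne'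
  have hL := continuous_cubeEntropy
  have hlog : Continuous fun t : ℝ => Real.log (t ^ 2 + t + 1) :=
    Continuous.log (by fun_prop) h
  have hinv : Continuous fun t : ℝ => 1 / (t ^ 2 + t + 1) :=
    continuous_const.div (by fun_prop) h
  have harc : Continuous fun t : ℝ => Real.arctan ((2 * t + 1) / √3) :=
    Real.continuous_arctan.comp (by fun_prop)
  unfold slopePrimitive
  fun_prop

lemma hasDerivAt_arctan_div_sqrt_three (t : ℝ) :
    HasDerivAt (fun t : ℝ => Real.arctan ((2 * t + 1) / √3) / √3)
      (1 / (2 * (t ^ 2 + t + 1))) t := by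
  have hq := (sq_add_self_add_one_pos t).ne'
  have h3 : √3 ^ 2 = 3 := Real.sq_sqrt (by norm_num)
  have h30 : √3 ≠ 0 := by positivity
  have hlin : HasDerivAt (fun t : ℝ => (2 * t + 1) / √3) (2 / √3) t := by
    simpa using (((hasDerivAt_id t).const_mul 2).add_const 1).div_const √3
  refine (hlin.arctan.div_const √3).congr_deriv ?_
  have : 1 + ((2 * t + 1) / √3) ^ 2 = 4 * (t ^ 2 + t + 1) / 3 := by
    rw [div_pow, h3]
    ring
  rw [this]
  have hq' : t * (t + 1) + 1 ≠ 0 := by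
    convert hq using 1
    ring
  field_simp
  linear_combination -4 * h3

lemma hasDerivAt_slopePrimitive {t : ℝ} (ht : 1 - t ^ 3 ≠ 0) :
    HasDerivAt slopePrimitive
      (-3 * t ^ 2 * ((3 / 8) * t ^ 3 - (9 / 16) * t ^ 6 + (1 / 4) * t ^ 9 - (1 / 12) * t)
        * (1 + Real.log (1 - t ^ 3))) t := by
  have hq := (sq_add_self_add_one_pos t).ne'
  have hp := fun n : ℕ => hasDerivAt_pow n t
  have hdq : HasDerivAt (fun t : ℝ => t ^ 2 + t + 1) (2 * t + 1) t := by
    simpa using ((hp 2).add (hasDerivAt_id t)).add_const 1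
  have hP := (((((hp 6).const_mul 3).sub ((hp 9).const_mul 3)).add (hp 12)).sub
    (hp 4)).const_mul (-(1 / 16))
  have hS := ((hp 3).mul (((hasDerivAt_const t (1 : ℝ)).div hdq hq).sub
    (((hp 3).const_sub 1).pow 2))).const_mul (1 / 16)
  have hR := (((((((hp 4).div_const 4).sub ((hp 3).div_const 3)).add (hasDerivAt_id t)).sub
    ((hdq.log hq).div_const 2)).sub (hasDerivAt_arctan_div_sqrt_three t)).sub
    ((((hp 6).div_const 6).sub (((hp 9).const_mul 2).div_const 9)).add
      ((hp 12).div_const 12))).const_mul (3 / 16)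
  refine ((hP.sub (hS.mul (hasDerivAt_cubeEntropy ht))).sub hR).congr_deriv ?_
  simp only [cubeEntropy, Pi.sub_apply, Pi.mul_apply, Pi.pow_apply, Pi.div_apply]
  push_cast
  generalize Real.log (1 - t ^ 3) = l
  have hq' : t * (t + 1) + 1 ≠ 0 := by
    convert hq using 1
    ring
  field_simp
  ring

lemma slopePrimitive_zero_sub_one :
    slopePrimitive 0 - slopePrimitive 1
      = 1 / 6 - (3 / 32) * Real.log 3 - (√3 / 96) * Real.pi := by
  have h3 : √3 ^ 2 = 3 := Real.sq_sqrt (by norm_num)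
  have h30 : √3 ≠ 0 := by positivity
  have h1 : Real.arctan (3 / √3) = Real.pi / 3 := by
    rw [Real.div_sqrt, Real.arctan_sqrt_three]
  have h0 : Real.arctan (√3)⁻¹ = Real.pi / 6 := Real.arctan_inv_sqrt_three
  norm_num [slopePrimitive, cubeEntropy, h1, h0]
  field_simp
  linear_combination (16 * 12 * 2 * 36 * 6 * 32 * Real.pi) * h3

/-- For the Lehmann alternative,
`4 ∫_0^∞ ψ(x) h₃(x) dx = 2/3 − (3/8) ln 3 − (√3/24) π`. -/
theorem lehmann_local_slope_coefficient :
    4 * ∫ x in Set.Ioi (0:ℝ), psi x * h3 x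
      = 2/3 - (3/8) * Real.log 3 - (Real.sqrt 3 / 24) * Real.pi := by
  have hcont : Continuous fun x : ℝ => slopePrimitive (exp (-x / 3)) :=
    continuous_slopePrimitive.comp (by fun_prop)
  have hint := integral_Ioi_of_hasDerivAt_of_tendsto (a := 0) (f' := fun x => psi x * h3 x)
    hcont.continuousWithinAt (fun x hx => ?_) integrableOn_psi_mul_h3
    ((continuous_slopePrimitive.tendsto 0).comp tendsto_exp_neg_div_three)
  · rw [hint]
    simp only [neg_zero, zero_div, Real.exp_zero]
    rw [slopePrimitive_zero_sub_one]
    ring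
  · have hpos := one_sub_pow_three_pos (exp_neg_div_three_lt_one hx)
    refine ((hasDerivAt_slopePrimitive hpos.ne').comp x
      (hasDerivAt_exp_neg_div_three x)).congr_deriv ?_
    rw [h3_eq, psi_eq]
    ring
end

section
/- For the Gamma alternative, whose density derivative at θ = 0 is h_4(x) = e^{-x}(ln x + γ) with γ the Euler–Mascheroni constant, one has 4 ∫_0^∞ ψ(x) h_4(x) dx = (1/2) ln 3 − (3/4) ln 2. -/
open Real MeasureTheory

/-- Derivative at `θ = 0` of the Gamma density `g₄(x,θ) = x^θ e^{-x} / Γ(θ+1)`,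
where `γ` is the Euler–Mascheroni constant. -/
noncomputable def h4 (x : ℝ) : ℝ := exp (-x) * (Real.log x + Real.eulerMascheroniConstant)

lemma integral_log_mul_exp_neg :
    ∫ x in Set.Ioi (0:ℝ), Real.log x * exp (-x) = -Real.eulerMascheroniConstant := by
  have hInt := Complex.hasDerivAt_GammaIntegral (s := 1) (by simp)
  have hGamma : HasDerivAt Complex.GammaIntegral (-(Real.eulerMascheroniConstant : ℂ)) 1 := by
    refine Complex.hasDerivAt_Gamma_one.congr_of_eventuallyEq ?_
    filter_upwards [(isOpen_lt continuous_const Complex.continuous_re).mem_nhds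
      (show (0:ℝ) < (1:ℂ).re by simp)] with s hs
    exact (Complex.Gamma_eq_integral hs).symm
  have h := hInt.unique hGamma
  simp only [sub_self, Complex.cpow_zero, one_mul] at h
  apply Complex.ofReal_injective
  rw [Complex.ofReal_neg, ← h, ← integral_complex_ofReal]
  simp only [Complex.ofReal_mul]

lemma integrableOn_log_mul_exp_neg :
    IntegrableOn (fun x : ℝ => Real.log x * exp (-x)) (Set.Ioi 0) := by
  refine Integrable.of_integral_ne_zero ?_
  rw [integral_log_mul_exp_neg]
  have := Real.one_half_lt_eulerMascheroniConstant
  linarith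

lemma integrableOn_exp_neg_mul_Ioi_zero {r : ℝ} (hr : 0 < r) :
    IntegrableOn (fun x : ℝ => exp (-(r * x))) (Set.Ioi 0) := by
  simpa only [neg_mul] using exp_neg_integrableOn_Ioi 0 hr

lemma exp_neg_mul_mul_log_add {r x : ℝ} (hr : 0 < r) (hx : 0 < x) (c : ℝ) :
    exp (-(r * x)) * (Real.log x + c) =
      Real.log (r * x) * exp (-(r * x)) + (c - Real.log r) * exp (-(r * x)) := by
  rw [Real.log_mul hr.ne' hx.ne']
  ring

lemma integrableOn_log_mul_exp_neg_comp_mul_left {r : ℝ} (hr : 0 < r) :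
    IntegrableOn (fun x : ℝ => Real.log (r * x) * exp (-(r * x))) (Set.Ioi 0) := by
  refine (integrableOn_Ioi_comp_mul_left_iff (fun x : ℝ => Real.log x * exp (-x)) 0 hr).mpr ?_
  simpa only [mul_zero] using integrableOn_log_mul_exp_neg

lemma integrableOn_exp_neg_mul_mul_log_add {r : ℝ} (hr : 0 < r) (c : ℝ) :
    IntegrableOn (fun x : ℝ => exp (-(r * x)) * (Real.log x + c)) (Set.Ioi 0) :=
  ((integrableOn_log_mul_exp_neg_comp_mul_left hr).add
    ((integrableOn_exp_neg_mul_Ioi_zero hr).const_mul (c - Real.log r))).congr_fun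
    (fun _ hx => (exp_neg_mul_mul_log_add hr hx c).symm) measurableSet_Ioi

lemma integral_exp_neg_mul_mul_log_add_eulerMascheroniConstant {r : ℝ} (hr : 0 < r) :
    ∫ x in Set.Ioi (0:ℝ), exp (-(r * x)) * (Real.log x + Real.eulerMascheroniConstant) =
      -(Real.log r / r) := by
  have hlog := integral_comp_mul_left_Ioi (fun x : ℝ => Real.log x * exp (-x)) 0 hr
  have hexp := integral_comp_mul_left_Ioi (fun x : ℝ => exp (-x)) 0 hr
  simp only [mul_zero, smul_eq_mul, integral_log_mul_exp_neg, integral_exp_neg_Ioi_zero]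
    at hlog hexp
  rw [setIntegral_congr_fun measurableSet_Ioi fun x hx => exp_neg_mul_mul_log_add hr hx _,
    integral_add (integrableOn_log_mul_exp_neg_comp_mul_left hr)
      ((integrableOn_exp_neg_mul_Ioi_zero hr).const_mul _),
    integral_const_mul, hlog, hexp]
  ring

lemma psi_mul_h4 (x : ℝ) :
    psi x * h4 x =
      (3/8) * (exp (-(2 * x)) * (Real.log x + Real.eulerMascheroniConstant))
      - (9/16) * (exp (-(3 * x)) * (Real.log x + Real.eulerMascheroniConstant))
      + (1/4) * (exp (-(4 * x)) * (Real.log x + Real.eulerMascheroniConstant))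
      - (1/12) * (exp (-((4/3) * x)) * (Real.log x + Real.eulerMascheroniConstant)) := by
  have e2 : exp (-(2 * x)) = exp (-x) * exp (-x) := by rw [← exp_add]; ring_nf
  have e3 : exp (-(3 * x)) = exp (-2 * x) * exp (-x) := by rw [← exp_add]; ring_nf
  have e4 : exp (-(4 * x)) = exp (-3 * x) * exp (-x) := by rw [← exp_add]; ring_nf
  have e43 : exp (-((4/3) * x)) = exp (-x / 3) * exp (-x) := by rw [← exp_add]; ring_nf
  rw [e2, e3, e4, e43, psi, h4]
  ring

/-- For the Gamma alternative, `4 ∫_0^∞ ψ(x) h₄(x) dx = (1/2) ln 3 − (3/4) ln 2`. -/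
theorem gamma_local_slope_coefficient :
    4 * ∫ x in Set.Ioi (0:ℝ), psi x * h4 x = (1/2) * Real.log 3 - (3/4) * Real.log 2 := by
  have hi (a : ℝ) {r : ℝ} (hr : 0 < r) :=
    (integrableOn_exp_neg_mul_mul_log_add hr Real.eulerMascheroniConstant).const_mul a
  have i2 := hi (3/8) (r := 2) (by norm_num)
  have i3 := hi (9/16) (r := 3) (by norm_num)
  have i4 := hi (1/4) (r := 4) (by norm_num)
  have i43 := hi (1/12) (r := 4/3) (by norm_num)
  have hlog4 : Real.log 4 = 2 * Real.log 2 := by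
    rw [show (4:ℝ) = 2 ^ 2 by norm_num, Real.log_pow]
    norm_num
  simp_rw [psi_mul_h4]
  rw [integral_sub (by exact (i2.sub i3).add i4) i43, integral_add (by exact i2.sub i3) i4,
    integral_sub i2 i3]
  simp only [integral_const_mul]
  rw [integral_exp_neg_mul_mul_log_add_eulerMascheroniConstant (by norm_num),
    integral_exp_neg_mul_mul_log_add_eulerMascheroniConstant (by norm_num),
    integral_exp_neg_mul_mul_log_add_eulerMascheroniConstant (by norm_num),
    integral_exp_neg_mul_mul_log_add_eulerMascheroniConstant (by norm_num),
    Real.log_div (by norm_num) (by norm_num), hlog4]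
  ring
end

section
/- Let K_1(θ) = inf_{λ>0} ∫_0^∞ g_1(x,θ) ln( g_1(x,θ) / (λ e^{-λ x}) ) dx be the Kullback–Leibler distance from the Makeham distribution with parameter θ to the class of exponential distributions. Then K_1(θ) ~ θ²/24 as θ → 0+, i.e. lim_{θ→0+} K_1(θ)/θ² = 1/24. -/
open Real MeasureTheory Filter Topology

/-- The Makeham density `g₁(x,θ) = (1+θ(1−e^{-x})) exp(−x − θ(e^{-x} − 1 + x))`. -/
noncomputable def makehamDensity (x θ : ℝ) : ℝ :=
  (1 + θ * (1 - exp (-x))) * exp (-x - θ * (exp (-x) - 1 + x))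

/-- Kullback–Leibler distance from the Makeham distribution with parameter `θ`
to the class of exponential distributions. -/
noncomputable def makehamKL (θ : ℝ) : ℝ :=
  ⨅ l : Set.Ioi (0:ℝ), ∫ x in Set.Ioi (0:ℝ),
    makehamDensity x θ * Real.log (makehamDensity x θ / ((l : ℝ) * exp (-(l : ℝ) * x)))

/-- `f` is integrable on `(0, ∞)` with integral `a`. -/
def HasIntegralIoi (f : ℝ → ℝ) (a : ℝ) : Prop :=
  IntegrableOn f (Set.Ioi 0) ∧ ∫ x in Set.Ioi (0:ℝ), f x = a

namespace HasIntegralIoi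

variable {f g : ℝ → ℝ} {a b : ℝ}

lemma add (hf : HasIntegralIoi f a) (hg : HasIntegralIoi g b) :
    HasIntegralIoi (fun x => f x + g x) (a + b) :=
  ⟨hf.1.add hg.1, by rw [integral_add hf.1 hg.1, hf.2, hg.2]⟩

lemma const_mul (hf : HasIntegralIoi f a) (c : ℝ) :
    HasIntegralIoi (fun x => c * f x) (c * a) :=
  ⟨hf.1.const_mul c, by rw [integral_const_mul, hf.2]⟩

lemma sub (hf : HasIntegralIoi f a) (hg : HasIntegralIoi g b) :
    HasIntegralIoi (fun x => f x - g x) (a - b) :=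
  ⟨hf.1.sub hg.1, by rw [integral_sub hf.1 hg.1, hf.2, hg.2]⟩

lemma congr (hf : HasIntegralIoi f a) (h : ∀ x, 0 < x → g x = f x) (hab : b = a) :
    HasIntegralIoi g b := by
  have h' : Set.EqOn f g (Set.Ioi 0) := fun x hx => (h x hx).symm
  exact ⟨hf.1.congr_fun h' measurableSet_Ioi,
    by rw [hab, ← hf.2, setIntegral_congr_fun measurableSet_Ioi h']⟩

lemma of_abs_le (hg : HasIntegralIoi g b) (hf : Measurable f)
    (h : ∀ x, 0 < x → |f x| ≤ g x) :
    HasIntegralIoi f (∫ x in Set.Ioi (0:ℝ), f x) :=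
  ⟨Integrable.mono' hg.1 hf.aestronglyMeasurable
    ((ae_restrict_iff' measurableSet_Ioi).2 (Eventually.of_forall fun x hx => by simpa using h x hx)), rfl⟩

lemma abs_le (hf : HasIntegralIoi f a) (hg : HasIntegralIoi g b)
    (h : ∀ x, 0 < x → |f x| ≤ g x) : |a| ≤ b := by
  rw [← hf.2, ← hg.2, ← Real.norm_eq_abs]
  exact norm_integral_le_of_norm_le hg.1
    ((ae_restrict_iff' measurableSet_Ioi).2 (Eventually.of_forall fun x hx => by simpa using h x hx))

lemma of_deriv {f' : ℝ → ℝ} (hd : ∀ x, HasDerivAt f (f' x) x)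
    (hf : HasIntegralIoi f a) (hf' : HasIntegralIoi f' b) : b = -f 0 := by
  have ht := tendsto_zero_of_hasDerivAt_of_integrableOn_Ioi (fun x _ => hd x) hf'.1 hf.1
  rw [← hf'.2, integral_Ioi_of_hasDerivAt_of_tendsto' (fun x _ => hd x) hf'.1 ht, zero_sub]

end HasIntegralIoi

lemma hasIntegralIoi_pow_mul_exp (n k : ℕ) :
    HasIntegralIoi (fun x => x ^ n * exp (-x) ^ (k + 1)) (n.factorial / ((k:ℝ) + 1) ^ (n + 1)) := by
  have hk : (0:ℝ) < k + 1 := by positivity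
  have hn : (-1:ℝ) < n := by linarith [(Nat.cast_nonneg n : (0:ℝ) ≤ n)]
  have e : ∀ x : ℝ, exp (-x) ^ (k + 1) = exp (-((k + 1) * x)) := fun x => by
    rw [← Real.exp_nat_mul]; congr 1; push_cast; ring
  constructor
  · have := integrableOn_rpow_mul_exp_neg_mul_rpow hn one_pos hk
    simpa only [e, Real.rpow_natCast, Real.rpow_one, neg_mul] using this
  · have := Real.integral_rpow_mul_exp_neg_mul_Ioi (a := (n:ℝ) + 1) (by positivity) hk
    rw [Real.Gamma_nat_eq_factorial, ← Nat.cast_succ, Real.rpow_natCast] at this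
    simp only [Nat.cast_succ, add_sub_cancel_right, Real.rpow_natCast] at this
    simp only [e, this]
    rw [one_div, inv_pow, Nat.succ_eq_add_one]
    field_simp

lemma abs_exp_neg_sub_linear_le {t : ℝ} (ht : 0 ≤ t) : |exp (-t) - (1 - t)| ≤ t ^ 2 / 2 := by
  have h1 := Real.one_sub_le_exp_neg t
  have h2 := Real.quadratic_le_exp_of_nonneg ht
  have h3 : exp (-t) * exp t = 1 := by rw [← Real.exp_add]; simp
  have h4 : exp (-t) * (1 + t + t ^ 2 / 2) ≤ 1 := by
    exact (mul_le_mul_of_nonneg_left h2 (Real.exp_pos (-t)).le).trans h3.le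
  rw [abs_le]
  constructor
  · nlinarith [sq_nonneg t]
  · have h5 : exp (-t) ≤ 1 / (1 + t + t ^ 2 / 2) := by
      rw [le_div_iff₀ (by positivity)]; exact h4
    have h6 : 1 / (1 + t + t ^ 2 / 2) ≤ 1 - t + t ^ 2 / 2 := by
      rw [div_le_iff₀ (by positivity)]; nlinarith [sq_nonneg (t ^ 2)]
    linarith

lemma abs_exp_neg_sub_quadratic_le {t : ℝ} (ht : 0 ≤ t) :
    |exp (-t) - (1 - t + t ^ 2 / 2)| ≤ t ^ 3 := by
  rcases le_total t 1 with h | h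
  · have := Real.exp_bound (x := -t) (by rwa [abs_neg, abs_of_nonneg ht]) (n := 3) (by norm_num)
    norm_num [Finset.sum_range_succ, Nat.factorial, abs_of_nonneg ht] at this
    have h3 : 0 ≤ t ^ 3 := by positivity
    calc _ = |exp (-t) - (1 + -t + t ^ 2 / 2)| := by ring_nf
      _ ≤ _ := by linarith
  · have h2 := abs_le.1 (abs_exp_neg_sub_linear_le ht)
    have h0 := Real.exp_pos (-t)
    rw [abs_le]
    constructor <;> nlinarith [pow_pos (zero_lt_one.trans_le h) 2, pow_pos (zero_lt_one.trans_le h) 3]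

lemma abs_log_one_add_sub_quadratic_le {y : ℝ} (hy : |y| ≤ 1 / 2) :
    |log (1 + y) - (y - y ^ 2 / 2)| ≤ 2 * |y| ^ 3 := by
  have := Real.abs_log_sub_add_sum_range_le (x := -y) (by rw [abs_neg]; linarith) 2
  norm_num [Finset.sum_range_succ] at this
  have h : |y| ^ 3 / (1 - |y|) ≤ 2 * |y| ^ 3 := by
    rw [div_le_iff₀ (by linarith)]
    nlinarith [pow_nonneg (abs_nonneg y) 3]
  calc _ = |-y + y ^ 2 / 2 + log (1 + y)| := by ring_nf
    _ ≤ _ := this.trans h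

lemma abs_mul_log_sub_le {s : ℝ} (h0 : 0 ≤ s) (h1 : s ≤ 1 / 2) :
    |(1 + s) * log (1 + s) - (s + s ^ 2 / 2)| ≤ 4 * s ^ 3 := by
  have := abs_le.1 (abs_log_one_add_sub_quadratic_le (y := s) (by rwa [abs_of_nonneg h0]))
  rw [abs_of_nonneg h0] at this
  have h3 : 0 ≤ s ^ 3 := by positivity
  have h4 : 0 ≤ (1 / 2 - s) * s ^ 3 := mul_nonneg (by linarith) h3
  have ha := mul_nonneg (by linarith : 0 ≤ 1 + s) (sub_nonneg.2 this.1)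
  have hb := mul_nonneg (by linarith : 0 ≤ 1 + s) (sub_nonneg.2 this.2)
  rw [abs_le]
  constructor <;> nlinarith

/-- The cumulative hazard of the Makeham distribution. -/
noncomputable def makehamHazard (θ x : ℝ) : ℝ := x + θ * (exp (-x) - 1 + x)

lemma makehamDensity_eq (θ x : ℝ) :
    makehamDensity x θ = (1 + θ * (1 - exp (-x))) * exp (-makehamHazard θ x) := by
  unfold makehamDensity makehamHazard
  congr 2; ring

lemma hasDerivAt_makehamHazard (θ x : ℝ) :
    HasDerivAt (makehamHazard θ) (1 + θ * (1 - exp (-x))) x := by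
  have h1 : HasDerivAt (fun x : ℝ => exp (-x)) (-exp (-x)) x := by
    simpa using (hasDerivAt_neg x).exp
  exact ((hasDerivAt_id x).add (((h1.sub_const 1).add (hasDerivAt_id x)).const_mul θ)).congr_deriv
    (by ring)

lemma hasDerivAt_exp_neg_makehamHazard (θ x : ℝ) :
    HasDerivAt (fun x => exp (-makehamHazard θ x)) (-makehamDensity x θ) x := by
  exact (hasDerivAt_makehamHazard θ x).neg.exp.congr_deriv
    (by rw [makehamDensity_eq, Pi.neg_apply]; ring)

@[fun_prop]
lemma measurable_makehamHazard (θ : ℝ) : Measurable (makehamHazard θ) := by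
  unfold makehamHazard; fun_prop

@[fun_prop]
lemma measurable_makehamDensity (θ : ℝ) : Measurable (fun x => makehamDensity x θ) := by
  unfold makehamDensity; fun_prop

lemma exp_neg_sub_one_add_nonneg (x : ℝ) : 0 ≤ exp (-x) - 1 + x := by
  linarith [Real.one_sub_le_exp_neg x]

section

variable {θ x : ℝ}

lemma exp_neg_le_one_of_pos (hx : 0 < x) : exp (-x) ≤ 1 :=
  Real.exp_le_one_iff.2 (by linarith)

lemma exp_neg_makehamHazard_le (hθ : 0 ≤ θ) : exp (-makehamHazard θ x) ≤ exp (-x) := by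
  have := mul_nonneg hθ (exp_neg_sub_one_add_nonneg x)
  exact Real.exp_le_exp.2 (by unfold makehamHazard; linarith)

lemma exp_neg_makehamHazard_eq :
    exp (-makehamHazard θ x) = exp (-x) * exp (-(θ * (exp (-x) - 1 + x))) := by
  rw [← Real.exp_add]; unfold makehamHazard; congr 1; ring

lemma makehamHazard_mem (hθ : 0 ≤ θ) (hθ1 : θ ≤ 1) (hx : 0 < x) :
    0 ≤ makehamHazard θ x ∧ makehamHazard θ x ≤ 2 * x := by
  have h1 := exp_neg_sub_one_add_nonneg x
  have h2 := exp_neg_le_one_of_pos hx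
  unfold makehamHazard
  constructor
  · positivity
  · nlinarith

lemma mul_one_sub_exp_neg_mem (hθ : 0 ≤ θ) (hx : 0 < x) :
    0 ≤ θ * (1 - exp (-x)) ∧ θ * (1 - exp (-x)) ≤ θ := by
  have h2 := exp_neg_le_one_of_pos hx
  have h3 := Real.exp_pos (-x)
  constructor <;> nlinarith

lemma makehamDensity_pos (hθ : 0 ≤ θ) (hx : 0 < x) : 0 < makehamDensity x θ := by
  rw [makehamDensity_eq]
  have := (mul_one_sub_exp_neg_mem hθ hx).1
  positivity

lemma makehamDensity_le (hθ : 0 ≤ θ) (hθ1 : θ ≤ 1) (hx : 0 < x) :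
    makehamDensity x θ ≤ 2 * exp (-x) := by
  rw [makehamDensity_eq]
  have := mul_one_sub_exp_neg_mem hθ hx
  exact mul_le_mul (by linarith) (exp_neg_makehamHazard_le hθ) (Real.exp_pos _).le (by norm_num)

lemma hasIntegralIoi_makehamDensity (hθ : 0 ≤ θ) (hθ1 : θ ≤ 1) :
    HasIntegralIoi (fun x => makehamDensity x θ) 1 := by
  have hw := ((hasIntegralIoi_pow_mul_exp 0 0)).of_abs_le
    (f := fun x => exp (-makehamHazard θ x)) (by fun_prop) (fun x hx => by
      simpa using exp_neg_makehamHazard_le hθ)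
  have hg := ((hasIntegralIoi_pow_mul_exp 0 0).const_mul 2).of_abs_le
    (f := fun x => makehamDensity x θ) (by fun_prop) (fun x hx => by
      simpa [abs_of_pos (makehamDensity_pos hθ hx)] using makehamDensity_le hθ hθ1 hx)
  have := HasIntegralIoi.of_deriv (hasDerivAt_exp_neg_makehamHazard θ) hw
    ((hg.const_mul (-1)).congr (by simp) rfl)
  refine hg.congr (fun _ _ => rfl) ?_
  simp [makehamHazard] at this
  linarith

lemma hasIntegralIoi_mul_makehamDensity (hθ : 0 ≤ θ) (hθ1 : θ ≤ 1) :
    HasIntegralIoi (fun x => x * makehamDensity x θ)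
      (∫ x in Set.Ioi (0:ℝ), exp (-makehamHazard θ x)) := by
  have hw := ((hasIntegralIoi_pow_mul_exp 0 0)).of_abs_le
    (f := fun x => exp (-makehamHazard θ x)) (by fun_prop) (fun x hx => by
      simpa using exp_neg_makehamHazard_le hθ)
  have hxw := ((hasIntegralIoi_pow_mul_exp 1 0)).of_abs_le
    (f := fun x => x * exp (-makehamHazard θ x)) (by fun_prop) (fun x hx => by
      rw [abs_of_nonneg (by positivity)]
      simpa using mul_le_mul_of_nonneg_left (exp_neg_makehamHazard_le hθ) hx.le)
  have hxg := ((hasIntegralIoi_pow_mul_exp 1 0).const_mul 2).of_abs_le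
    (f := fun x => x * makehamDensity x θ) (by fun_prop) (fun x hx => by
      rw [abs_of_nonneg (mul_nonneg hx.le (makehamDensity_pos hθ hx).le)]
      have := mul_le_mul_of_nonneg_left (makehamDensity_le hθ hθ1 hx) hx.le
      simp only [pow_one, zero_add]; linarith)
  have := HasIntegralIoi.of_deriv
    (fun x => (hasDerivAt_id x).mul (hasDerivAt_exp_neg_makehamHazard θ x)) hxw
    ((hw.sub hxg).congr (fun x _ => by simp; ring) rfl)
  refine hxg.congr (fun _ _ => rfl) ?_
  simp at this
  linarith

lemma hasIntegralIoi_makehamHazard_mul_makehamDensity (hθ : 0 ≤ θ) (hθ1 : θ ≤ 1) :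
    HasIntegralIoi (fun x => makehamHazard θ x * makehamDensity x θ) 1 := by
  have hg := hasIntegralIoi_makehamDensity hθ hθ1
  have hHw := ((hasIntegralIoi_pow_mul_exp 1 0).const_mul 2).of_abs_le
    (f := fun x => makehamHazard θ x * exp (-makehamHazard θ x)) (by fun_prop) (fun x hx => by
      have h := makehamHazard_mem hθ hθ1 hx
      rw [abs_of_nonneg (mul_nonneg h.1 (Real.exp_pos _).le)]
      have := mul_le_mul h.2 (exp_neg_makehamHazard_le (x := x) hθ) (Real.exp_pos _).le (by positivity)
      simp only [pow_one, zero_add]; linarith)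
  have hHg := ((hasIntegralIoi_pow_mul_exp 1 0).const_mul 4).of_abs_le
    (f := fun x => makehamHazard θ x * makehamDensity x θ) (by fun_prop) (fun x hx => by
      have h := makehamHazard_mem hθ hθ1 hx
      rw [abs_of_nonneg (mul_nonneg h.1 (makehamDensity_pos hθ hx).le)]
      have := mul_le_mul h.2 (makehamDensity_le hθ hθ1 hx) (makehamDensity_pos hθ hx).le
        (by positivity)
      simp only [pow_one, zero_add]; linarith)
  have := HasIntegralIoi.of_deriv
    (fun x => (hasDerivAt_makehamHazard θ x).mul (hasDerivAt_exp_neg_makehamHazard θ x)) hHw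
    ((hg.sub hHg).congr (fun x _ => by simp [makehamDensity_eq]; ring) rfl)
  refine hHg.congr (fun _ _ => rfl) ?_
  simp [makehamHazard] at this
  unfold makehamHazard
  linarith

lemma hasIntegralIoi_makehamDensity_mul_log (hθ : 0 ≤ θ) (hθ1 : θ ≤ 1) :
    HasIntegralIoi (fun x => makehamDensity x θ * log (1 + θ * (1 - exp (-x))))
      (∫ x in Set.Ioi (0:ℝ), makehamDensity x θ * log (1 + θ * (1 - exp (-x)))) := by
  refine ((hasIntegralIoi_pow_mul_exp 0 0).const_mul 2).of_abs_le (by fun_prop) fun x hx => ?_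
  have h := mul_one_sub_exp_neg_mem hθ hx
  have h1 := Real.log_nonneg (show 1 ≤ 1 + θ * (1 - exp (-x)) by linarith)
  have h2 := Real.log_le_sub_one_of_pos (show 0 < 1 + θ * (1 - exp (-x)) by linarith)
  rw [abs_of_nonneg (mul_nonneg (makehamDensity_pos hθ hx).le h1)]
  have := mul_le_mul (makehamDensity_le hθ hθ1 hx)
    (show log (1 + θ * (1 - exp (-x))) ≤ 1 by linarith) h1 (by positivity)
  simpa using this

lemma abs_integral_exp_neg_makehamHazard_sub_le (hθ : 0 ≤ θ) :
    |(∫ x in Set.Ioi (0:ℝ), exp (-makehamHazard θ x)) - (1 - θ / 2 + 5 / 12 * θ ^ 2)|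
      ≤ 6 * θ ^ 3 := by
  have P := hasIntegralIoi_pow_mul_exp
  have hw := (P 0 0).of_abs_le
    (f := fun x => exp (-makehamHazard θ x)) (by fun_prop) (fun x hx => by
      simpa using exp_neg_makehamHazard_le hθ)
  have hv := ((P 0 1).sub (P 0 0)).add (P 1 0)
  have hv2 := ((((P 0 2).add (P 0 0)).add (P 2 0)).add ((P 1 1).const_mul 2)).sub
    (((P 0 1).add (P 1 0)).const_mul 2)
  have hp : HasIntegralIoi (fun x => exp (-x) * (1 - θ * (exp (-x) - 1 + x) +
      (θ * (exp (-x) - 1 + x)) ^ 2 / 2)) (1 - θ / 2 + 5 / 12 * θ ^ 2) := by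
    refine (((P 0 0).sub (hv.const_mul θ)).add (hv2.const_mul (θ ^ 2 / 2))).congr
      (fun x _ => by ring) ?_
    norm_num [Nat.factorial]; ring
  refine (hw.sub hp).abs_le (((P 3 0).const_mul (θ ^ 3)).congr (fun _ _ => rfl) ?_)
    fun x hx => ?_
  · norm_num [Nat.factorial]; ring
  have h1 := exp_neg_sub_one_add_nonneg x
  have h2 := exp_neg_le_one_of_pos hx
  have h3 := abs_exp_neg_sub_quadratic_le (mul_nonneg hθ h1)
  rw [exp_neg_makehamHazard_eq, ← mul_sub, abs_mul, abs_of_pos (Real.exp_pos _)]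
  calc _ ≤ exp (-x) * (θ * (exp (-x) - 1 + x)) ^ 3 := by gcongr
    _ ≤ exp (-x) * (θ * x) ^ 3 := by gcongr; linarith
    _ = _ := by ring

lemma abs_integral_makehamDensity_mul_log_sub_le (hθ : 0 ≤ θ) (hθ1 : θ ≤ 1 / 2) :
    |(∫ x in Set.Ioi (0:ℝ), makehamDensity x θ * log (1 + θ * (1 - exp (-x))))
      - (θ / 2 - θ ^ 2 / 4)| ≤ 7 * θ ^ 3 := by
  have P := hasIntegralIoi_pow_mul_exp
  have hB := hasIntegralIoi_makehamDensity_mul_log hθ (by linarith)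
  have hu := (P 0 0).sub (P 0 1)
  have hu2 := ((P 0 0).sub ((P 0 1).const_mul 2)).add (P 0 2)
  have huv := ((P 1 0).sub (P 1 1)).sub hu2
  have hp : HasIntegralIoi (fun x => exp (-x) * (θ * (1 - exp (-x)) + (θ * (1 - exp (-x))) ^ 2 / 2
      - θ * (1 - exp (-x)) * (θ * (exp (-x) - 1 + x)))) (θ / 2 - θ ^ 2 / 4) := by
    refine ((hu.const_mul θ).add ((hu2.const_mul (θ ^ 2 / 2)).sub (huv.const_mul (θ ^ 2)))).congr
      (fun x _ => by ring) ?_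
    norm_num [Nat.factorial]; ring
  refine (hB.sub hp).abs_le
    (((((P 0 0).const_mul 4).add ((P 1 0).add (P 2 0))).const_mul (θ ^ 3)).congr
      (fun _ _ => rfl) ?_) fun x hx => ?_
  · norm_num [Nat.factorial]; ring
  have h1 := exp_neg_sub_one_add_nonneg x
  have h2 := exp_neg_le_one_of_pos hx
  obtain ⟨hs0, hs1⟩ := mul_one_sub_exp_neg_mem hθ hx
  have ht0 := mul_nonneg hθ h1
  have ht1 : θ * (exp (-x) - 1 + x) ≤ θ * x := by gcongr; linarith
  have h3 := abs_exp_neg_sub_linear_le ht0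
  have he : exp (-(θ * (exp (-x) - 1 + x))) ≤ 1 := Real.exp_le_one_iff.2 (by linarith)
  have h4 := abs_mul_log_sub_le hs0 (hs1.trans hθ1)
  rw [makehamDensity_eq, exp_neg_makehamHazard_eq]
  set s := θ * (1 - exp (-x))
  set t := θ * (exp (-x) - 1 + x)
  have key : |(1 + s) * log (1 + s) * exp (-t) - (s + s ^ 2 / 2 - s * t)|
      ≤ θ ^ 3 * (4 + x + x ^ 2) := by
    have e : (1 + s) * log (1 + s) * exp (-t) - (s + s ^ 2 / 2 - s * t) =
        ((1 + s) * log (1 + s) - (s + s ^ 2 / 2)) * exp (-t)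
        + (s + s ^ 2 / 2) * (exp (-t) - (1 - t)) - s ^ 2 * t / 2 := by ring
    have b1 : |((1 + s) * log (1 + s) - (s + s ^ 2 / 2)) * exp (-t)| ≤ 4 * θ ^ 3 * 1 := by
      rw [abs_mul, abs_of_pos (Real.exp_pos (-t))]
      have : 4 * s ^ 3 ≤ 4 * θ ^ 3 := by gcongr
      exact mul_le_mul (h4.trans this) he (Real.exp_pos _).le (by positivity)
    have b2 : |(s + s ^ 2 / 2) * (exp (-t) - (1 - t))| ≤ 2 * θ * ((θ * x) ^ 2 / 2) := by
      rw [abs_mul, abs_of_nonneg (a := s + s ^ 2 / 2) (by positivity)]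
      have : t ^ 2 / 2 ≤ (θ * x) ^ 2 / 2 := by gcongr
      exact mul_le_mul (by nlinarith) (h3.trans this) (abs_nonneg _) (by positivity)
    have b3 : |s ^ 2 * t / 2| ≤ θ ^ 2 * (θ * x) := by
      rw [abs_of_nonneg (by positivity)]
      have : s ^ 2 * t ≤ θ ^ 2 * (θ * x) := by gcongr
      have : 0 ≤ s ^ 2 * t := by positivity
      linarith
    rw [e]
    have c1 := abs_sub (((1 + s) * log (1 + s) - (s + s ^ 2 / 2)) * exp (-t)
        + (s + s ^ 2 / 2) * (exp (-t) - (1 - t))) (s ^ 2 * t / 2)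
    have c2 := abs_add_le (((1 + s) * log (1 + s) - (s + s ^ 2 / 2)) * exp (-t))
      ((s + s ^ 2 / 2) * (exp (-t) - (1 - t)))
    nlinarith
  calc _ = |exp (-x) * ((1 + s) * log (1 + s) * exp (-t) - (s + s ^ 2 / 2 - s * t))| := by
        congr 1; ring
    _ = exp (-x) * |(1 + s) * log (1 + s) * exp (-t) - (s + s ^ 2 / 2 - s * t)| := by
        rw [abs_mul, abs_of_pos (Real.exp_pos _)]
    _ ≤ exp (-x) * (θ ^ 3 * (4 + x + x ^ 2)) := by gcongr
    _ = _ := by ring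

lemma integral_makehamDensity_mul_log_div {l : ℝ} (hθ : 0 ≤ θ) (hθ1 : θ ≤ 1) (hl : 0 < l) :
    ∫ x in Set.Ioi (0:ℝ), makehamDensity x θ * log (makehamDensity x θ / (l * exp (-l * x))) =
      (∫ x in Set.Ioi (0:ℝ), makehamDensity x θ * log (1 + θ * (1 - exp (-x)))) - 1 - log l
        + l * ∫ x in Set.Ioi (0:ℝ), exp (-makehamHazard θ x) := by
  have h := (((hasIntegralIoi_makehamDensity_mul_log hθ hθ1).sub
    (hasIntegralIoi_makehamHazard_mul_makehamDensity hθ hθ1)).sub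
    ((hasIntegralIoi_makehamDensity hθ hθ1).const_mul (log l))).add
    ((hasIntegralIoi_mul_makehamDensity hθ hθ1).const_mul l)
  rw [mul_one] at h
  refine (h.congr (fun x hx => ?_) rfl).2
  have h1 := (mul_one_sub_exp_neg_mem hθ hx).1
  rw [Real.log_div (makehamDensity_pos hθ hx).ne' (by positivity),
    Real.log_mul hl.ne' (Real.exp_pos _).ne', Real.log_exp]
  have : log (makehamDensity x θ) = log (1 + θ * (1 - exp (-x))) - makehamHazard θ x := by
    rw [makehamDensity_eq, Real.log_mul (by linarith) (Real.exp_pos _).ne', Real.log_exp]; ring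
  rw [this]; ring

lemma makehamKL_eq (hθ : 0 ≤ θ) (hθ1 : θ ≤ 1)
    (hm : 0 < ∫ x in Set.Ioi (0:ℝ), exp (-makehamHazard θ x)) :
    makehamKL θ =
      (∫ x in Set.Ioi (0:ℝ), makehamDensity x θ * log (1 + θ * (1 - exp (-x))))
        + log (∫ x in Set.Ioi (0:ℝ), exp (-makehamHazard θ x)) := by
  refine IsLeast.csInf_eq ⟨⟨⟨_, inv_pos.2 hm⟩, ?_⟩, ?_⟩
  · dsimp only
    rw [integral_makehamDensity_mul_log_div hθ hθ1 (inv_pos.2 hm), Real.log_inv,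
      inv_mul_cancel₀ hm.ne']
    ring
  · rintro _ ⟨⟨l, hl⟩, rfl⟩
    have hl : 0 < l := hl
    dsimp only
    rw [integral_makehamDensity_mul_log_div hθ hθ1 hl]
    have := Real.log_le_sub_one_of_pos (mul_pos hl hm)
    rw [Real.log_mul hl.ne' hm.ne'] at this
    linarith

lemma abs_makehamKL_sub_le (hθ : 0 < θ) (hθ1 : θ ≤ 1 / 10) :
    |makehamKL θ - θ ^ 2 / 24| ≤ 30 * θ ^ 3 := by
  have hM := abs_integral_exp_neg_makehamHazard_sub_le hθ.le
  have hB := abs_integral_makehamDensity_mul_log_sub_le hθ.le (by linarith)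
  have hK := makehamKL_eq hθ.le (by linarith)
  set m := ∫ x in Set.Ioi (0:ℝ), exp (-makehamHazard θ x)
  set B := ∫ x in Set.Ioi (0:ℝ), makehamDensity x θ * log (1 + θ * (1 - exp (-x)))
  obtain ⟨hM1, hM2⟩ := abs_le.1 hM
  obtain ⟨hB1, hB2⟩ := abs_le.1 hB
  have q2 : θ ^ 2 ≤ θ / 10 := by nlinarith
  have q3 : θ ^ 3 ≤ θ ^ 2 / 10 := by nlinarith [sq_nonneg θ]
  have p3 : 0 < θ ^ 3 := by positivity
  have p2 : 0 < θ ^ 2 := by positivity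
  rw [hK (by linarith)]
  obtain ⟨y, hym⟩ : ∃ y, y = m - 1 := ⟨_, rfl⟩
  rw [show m = 1 + y by linarith] at hM1 hM2 ⊢
  clear hym
  have hy : |y| ≤ θ := by rw [abs_le]; constructor <;> linarith
  have hlog := abs_log_one_add_sub_quadratic_le (y := y) (by linarith)
  have hy3 : |y| ^ 3 ≤ θ ^ 3 := by gcongr
  obtain ⟨w, rfl⟩ : ∃ w, y = w - θ / 2 := ⟨y + θ / 2, by ring⟩
  have hw : |w| ≤ 2 * θ ^ 2 := by rw [abs_le]; constructor <;> linarith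
  have hw1 : |θ * w| ≤ 2 * θ ^ 3 := by
    rw [abs_mul, abs_of_pos hθ]
    nlinarith [mul_le_mul_of_nonneg_left hw hθ.le]
  have hw2 : w ^ 2 ≤ θ ^ 3 := by
    rw [← sq_abs]
    calc |w| ^ 2 ≤ (2 * θ ^ 2) ^ 2 := by gcongr
      _ = 4 * θ * θ ^ 3 := by ring
      _ ≤ 1 * θ ^ 3 := by gcongr; linarith
      _ = _ := one_mul _
  obtain ⟨l1, l2⟩ := abs_le.1 hlog
  obtain ⟨w1, w2⟩ := abs_le.1 hw1
  have w0 := sq_nonneg w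
  rw [abs_le]
  constructor <;> nlinarith

end

/-- `K₁(θ) ~ θ²/24` as `θ → 0+`. -/
theorem makehamKL_asymptotics :
    Tendsto (fun θ => makehamKL θ / θ^2) (𝓝[>] 0) (𝓝 (1/24)) := by
  rw [tendsto_iff_norm_sub_tendsto_zero]
  have h0 : Tendsto (fun θ : ℝ => 30 * θ) (𝓝[>] 0) (𝓝 0) := by
    have : Tendsto (fun θ : ℝ => 30 * θ) (𝓝 0) (𝓝 0) := by
      simpa using (tendsto_id (x := 𝓝 (0:ℝ))).const_mul 30
    exact this.mono_left nhdsWithin_le_nhds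
  refine squeeze_zero' (Eventually.of_forall fun _ => norm_nonneg _) ?_ h0
  filter_upwards [Ioc_mem_nhdsGT (show (0:ℝ) < 1 / 10 by norm_num)] with θ hθ
  have hp : 0 < θ ^ 2 := pow_pos hθ.1 2
  have e : makehamKL θ / θ ^ 2 - 1 / 24 = (makehamKL θ - θ ^ 2 / 24) / θ ^ 2 := by
    rw [sub_div, div_right_comm, div_self hp.ne']
  rw [e, Real.norm_eq_abs, abs_div, abs_of_pos hp, div_le_iff₀ hp]
  calc _ ≤ 30 * θ ^ 3 := abs_makehamKL_sub_le hθ.1 hθ.2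
    _ = _ := by ring
end
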